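/- arXiv:2102.05522 — 2 statements merged into one kernel-verified Lean document; each statement's English description precedes it below -/
import Mathlib

section
/- For all positive integers a and b with b ≥ 2, the chromatic threshold of the family of a-locally b-partite graphs equals 1 − 1/(a + b − 1). That is, (i) for every d > 1 − 1/(a+b−1) there exists C such that every a-locally b-partite graph G with δ(G) ≥ d·|G| has χ(G) ≤ C, and (ii) for every d < 1 − 1/(a+b−1) and every C there exists an a-locally b-partite graph G with δ(G) ≥ d·|G| and χ(G) > C. -/
/-- A graph `G` is *a-locally b-partite* if for every clique on `a` vertices, the induced
subgraph on the common neighbourhood of the clique is `b`-colourable. -/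
def ALocallyBPartite {V : Type*} (G : SimpleGraph V) (a b : ℕ) : Prop :=
  ∀ s : Finset V, G.IsNClique a s →
    (G.induce {v | ∀ u ∈ s, G.Adj u v}).Colorable b

/-- Trading one colour for one more clique vertex. -/
theorem ALocallyBPartite.succ_left {V : Type*} {G : SimpleGraph V} {a b : ℕ}
    (h : ALocallyBPartite G a (b + 1)) : ALocallyBPartite G (a + 1) b := by
  classical
  intro s hs
  obtain ⟨v, hv⟩ : s.Nonempty := by
    rw [← Finset.card_pos, hs.card_eq]; omega
  have ht : G.IsNClique a (s.erase v) := by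
    refine ⟨hs.isClique.subset (by simp), ?_⟩
    rw [Finset.card_erase_of_mem hv, hs.card_eq]; simp
  obtain ⟨col⟩ := h _ ht
  have hv' : v ∈ {x | ∀ u ∈ s.erase v, G.Adj u x} := by
    intro u hu
    exact hs.isClique (Finset.mem_of_mem_erase hu) hv (Finset.ne_of_mem_erase hu)
  have hsub : ∀ x, x ∈ {x | ∀ u ∈ s, G.Adj u x} → x ∈ {x | ∀ u ∈ s.erase v, G.Adj u x} :=
    fun x hx u hu => hx u (Finset.mem_of_mem_erase hu)
  let col' : (G.induce {x | ∀ u ∈ s, G.Adj u x}).Coloring {c : Fin (b + 1) // c ≠ col ⟨v, hv'⟩} :=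
    SimpleGraph.Coloring.mk
      (fun x => ⟨col ⟨x.1, hsub _ x.2⟩, fun heq => by
        have hadj : G.Adj v x.1 := x.2 v hv
        exact col.valid (v := ⟨v, hv'⟩) (w := ⟨x.1, hsub _ x.2⟩) hadj heq.symm⟩)
      (by
        intro x y hxy heq
        exact col.valid (v := ⟨x.1, hsub _ x.2⟩) (w := ⟨y.1, hsub _ y.2⟩) hxy
          (congrArg Subtype.val heq))
  simpa using col'.colorable

theorem ALocallyBPartite.add_left {V : Type*} {G : SimpleGraph V} {a b : ℕ} (c : ℕ)
    (h : ALocallyBPartite G a (b + c)) : ALocallyBPartite G (a + c) b := by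
  induction c generalizing a with
  | zero => exact h
  | succ c ih =>
    have := ih (a := a + 1) (ALocallyBPartite.succ_left h)
    rwa [Nat.add_right_comm a 1 c] at this

open Finset in
/-- The second moment of a sum of independent centred bounded samples. -/
theorem sum_sq_sum_samples_le {V : Type*} [Fintype V] (f : V → ℝ) (B : ℝ)
    (hf : ∑ u, f u = 0) (hB : ∀ u, f u ^ 2 ≤ B) (m : ℕ) :
    ∑ U : Fin m → V, (∑ l, f (U l)) ^ 2 ≤ m * (Fintype.card V : ℝ) ^ m * B := by
  induction m with
  | zero => simp
  | succ m ih =>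
    have hsq : ∑ u, f u ^ 2 ≤ Fintype.card V * B := by
      calc ∑ u, f u ^ 2 ≤ ∑ _u : V, B := sum_le_sum fun u _ => hB u
        _ = _ := by simp
    have key : ∑ U : Fin (m + 1) → V, (∑ l, f (U l)) ^ 2
        = (Fintype.card V : ℝ) ^ m * ∑ u, f u ^ 2
          + Fintype.card V * ∑ U : Fin m → V, (∑ l, f (U l)) ^ 2 := by
      rw [← (Fin.consEquiv fun _ : Fin (m + 1) => V).sum_comp, Fintype.sum_prod_type]
      have : ∀ (u : V) (U : Fin m → V),
          (∑ l, f ((Fin.consEquiv fun _ : Fin (m + 1) => V) (u, U) l)) ^ 2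
            = f u ^ 2 + 2 * f u * (∑ l, f (U l)) + (∑ l, f (U l)) ^ 2 := by
        intro u U
        rw [Fin.sum_univ_succ]
        simp [Fin.consEquiv]
        ring
      simp_rw [this, sum_add_distrib, ← mul_sum, ← sum_mul, ← mul_sum, hf]
      simp [← mul_sum]
    rw [key]
    have h1 := mul_le_mul_of_nonneg_left hsq (by positivity : 0 ≤ (Fintype.card V : ℝ) ^ m)
    have h2 := mul_le_mul_of_nonneg_left ih (by positivity : 0 ≤ (Fintype.card V : ℝ))
    push_cast
    calc _ ≤ _ := add_le_add h1 h2
      _ = _ := by ring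

open Finset in
/-- Smoothing the indicators of sets `S i` by a bounded kernel `κ` gives vectors of which only
boundedly many can be pairwise far apart. -/
theorem card_separated_le {V Y I : Type*} [Fintype V] [Nonempty V] [Fintype Y] [Nonempty Y]
    (S : I → Finset V) (κ : V → Y → ℝ) (h0 : ∀ u y, 0 ≤ κ u y) (h1 : ∀ u y, κ u y ≤ 1)
    (m : ℕ) (hm : 0 < m) (T : Finset I)
    (hT : ∀ i ∈ T, ∀ j ∈ T, i ≠ j → 32 * (Fintype.card V : ℝ) ^ 2 * Fintype.card Y
      < m * ∑ y, (∑ u ∈ S i, κ u y - ∑ u ∈ S j, κ u y) ^ 2) :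
    T.card ≤ 2 ^ (m + 1) := by
  classical
  set n : ℝ := (Fintype.card V : ℝ) with hn
  have hnpos : 0 < n := by rw [hn]; exact_mod_cast Fintype.card_pos
  have hYpos : 0 < (Fintype.card Y : ℝ) := by exact_mod_cast Fintype.card_pos
  have hmpos : 0 < (m : ℝ) := by exact_mod_cast hm
  let F : I → Y → ℝ := fun i y => ∑ u ∈ S i, κ u y
  let g : I → Y → V → ℝ := fun i y u => F i y - n * (if u ∈ S i then κ u y else 0)
  have hF0 : ∀ i y, 0 ≤ F i y := fun i y => sum_nonneg fun u _ => h0 u y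
  have hFn : ∀ i y, F i y ≤ n := fun i y => by
    calc F i y ≤ ∑ u ∈ S i, (1 : ℝ) := sum_le_sum fun u _ => h1 u y
      _ = ((S i).card : ℝ) := by simp
      _ ≤ n := by rw [hn]; exact_mod_cast card_le_univ _
  have hg0 : ∀ i y, ∑ u, g i y u = 0 := by
    intro i y
    simp only [g, sum_sub_distrib, ← mul_sum]
    simp [F, hn]
  have hgB : ∀ i y u, g i y u ^ 2 ≤ n ^ 2 := by
    intro i y u
    have hi0 : 0 ≤ (if u ∈ S i then κ u y else 0) := by split_ifs; exacts [h0 u y, le_rfl]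
    have hi1 : (if u ∈ S i then κ u y else 0) ≤ 1 := by split_ifs; exacts [h1 u y, zero_le_one]
    apply sq_le_sq'
    · have := hF0 i y
      simp only [g]; nlinarith
    · have := hFn i y
      simp only [g]; nlinarith
  let E : I → (Fin m → V) → ℝ := fun i U => ∑ y, (∑ l, g i y (U l)) ^ 2
  have hEsum : ∀ i, ∑ U, E i U ≤ Fintype.card Y * (m * n ^ m * n ^ 2) := by
    intro i
    simp only [E]
    rw [sum_comm]
    calc _ ≤ ∑ _y : Y, (m * n ^ m * n ^ 2) :=
          sum_le_sum fun y _ => sum_sq_sum_samples_le _ _ (hg0 i y) (hgB i y) m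
      _ = _ := by simp
  set b : ℝ := m * n ^ 2 * Fintype.card Y with hb
  have hbpos : 0 < b := by positivity
  obtain ⟨U, hU⟩ : ∃ U : Fin m → V, ∑ i ∈ T, E i U ≤ b * T.card := by
    by_contra! hcon
    have hlt : ∑ _U : Fin m → V, b * T.card < ∑ U : Fin m → V, ∑ i ∈ T, E i U :=
      sum_lt_sum_of_nonempty univ_nonempty fun U _ => hcon U
    rw [sum_comm] at hlt
    have hle : ∑ i ∈ T, ∑ U, E i U ≤ ∑ i ∈ T, Fintype.card Y * (m * n ^ m * n ^ 2) :=
      sum_le_sum fun i _ => hEsum i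
    simp only [sum_const, nsmul_eq_mul, card_univ, Fintype.card_fun, Fintype.card_fin] at hlt hle
    push_cast at hlt
    have : (n ^ m) * (b * T.card) = T.card * (Fintype.card Y * (m * n ^ m * n ^ 2)) := by
      rw [hb]; ring
    linarith
  let bad := T.filter fun i => 2 * b < E i U
  let good := T.filter fun i => ¬ 2 * b < E i U
  have hE0 : ∀ i, 0 ≤ E i U := fun i => sum_nonneg fun y _ => sq_nonneg _
  have hbad : 2 * bad.card ≤ T.card := by
    have : (bad.card : ℝ) * (2 * b) ≤ b * T.card := by
      calc (bad.card : ℝ) * (2 * b) = ∑ i ∈ bad, 2 * b := by simp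
        _ ≤ ∑ i ∈ bad, E i U := sum_le_sum fun i hi => (mem_filter.1 hi).2.le
        _ ≤ ∑ i ∈ T, E i U :=
          sum_le_sum_of_subset_of_nonneg (filter_subset _ _) fun i _ _ => hE0 i
        _ ≤ _ := hU
    have h2 : (2 * bad.card : ℝ) ≤ T.card := by
      by_contra! hc
      nlinarith
    exact_mod_cast h2
  have hgood : good.card ≤ 2 ^ m := by
    have hinj : Set.InjOn (fun i => univ.filter fun l : Fin m => U l ∈ S i) (good : Set I) := by
      intro i hi j hj hij
      by_contra hne
      have hi' := mem_filter.1 (mem_coe.1 hi)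
      have hj' := mem_filter.1 (mem_coe.1 hj)
      have hsep := hT i hi'.1 j hj'.1 hne
      have hpat : ∀ l, (U l ∈ S i ↔ U l ∈ S j) := fun l => by
        have := Finset.ext_iff.1 hij l
        simpa using this
      have hdiff : ∀ y, m * (F i y - F j y) = ∑ l, g i y (U l) - ∑ l, g j y (U l) := by
        intro y
        simp only [g, hpat, sum_sub_distrib]
        simp
        ring
      have hD : (m : ℝ) ^ 2 * ∑ y, (F i y - F j y) ^ 2 ≤ 2 * E i U + 2 * E j U := by
        simp only [E, mul_sum, ← sum_add_distrib]
        refine sum_le_sum fun y _ => ?_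
        rw [← mul_pow, hdiff]
        nlinarith [sq_nonneg (∑ l, g i y (U l) + ∑ l, g j y (U l))]
      have hle : (m : ℝ) * (m * ∑ y, (F i y - F j y) ^ 2) ≤ m * (32 * n ^ 2 * Fintype.card Y) := by
        have e1 := not_lt.1 hi'.2
        have e2 := not_lt.1 hj'.2
        calc _ = (m : ℝ) ^ 2 * ∑ y, (F i y - F j y) ^ 2 := by ring
          _ ≤ 32 * b := by linarith
          _ = _ := by rw [hb]; ring
      exact absurd hsep (not_lt.2 (le_of_mul_le_mul_left hle hmpos))
    calc good.card = (good.image fun i => univ.filter fun l : Fin m => U l ∈ S i).card :=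
          (card_image_of_injOn hinj).symm
      _ ≤ Fintype.card (Finset (Fin m)) := card_le_univ _
      _ = 2 ^ m := by simp
  have hsplit : bad.card + good.card = T.card := card_filter_add_card_filter_not _
  rw [pow_succ]
  omega

open Finset in
/-- The smoothed indicators fall into boundedly many classes of small diameter. -/
theorem exists_similarity_classes {V Y I : Type*} [Fintype V] [Nonempty V] [Fintype Y]
    [Nonempty Y] [Fintype I] (S : I → Finset V) (κ : V → Y → ℝ)
    (h0 : ∀ u y, 0 ≤ κ u y) (h1 : ∀ u y, κ u y ≤ 1) (m : ℕ) (hm : 0 < m) :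
    ∃ T : Finset I, T.card ≤ 2 ^ (m + 1) ∧ ∃ c : I → T, ∀ i j, c i = c j →
      m * ∑ y, (∑ u ∈ S i, κ u y - ∑ u ∈ S j, κ u y) ^ 2
        ≤ 128 * (Fintype.card V : ℝ) ^ 2 * Fintype.card Y := by
  classical
  let D : I → I → ℝ := fun i j => m * ∑ y, (∑ u ∈ S i, κ u y - ∑ u ∈ S j, κ u y) ^ 2
  let K : ℝ := 32 * (Fintype.card V : ℝ) ^ 2 * Fintype.card Y
  have hDsymm : ∀ i j, D i j = D j i := fun i j => by
    simp only [D]; congr 1; exact sum_congr rfl fun y _ => by ring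
  have hDtri : ∀ i j t, D i j ≤ 2 * D i t + 2 * D j t := fun i j t => by
    have : ∑ y, (∑ u ∈ S i, κ u y - ∑ u ∈ S j, κ u y) ^ 2
        ≤ 2 * ∑ y, (∑ u ∈ S i, κ u y - ∑ u ∈ S t, κ u y) ^ 2
          + 2 * ∑ y, (∑ u ∈ S j, κ u y - ∑ u ∈ S t, κ u y) ^ 2 := by
      simp only [mul_sum, ← sum_add_distrib]
      refine sum_le_sum fun y _ => ?_
      nlinarith [sq_nonneg (∑ u ∈ S i, κ u y + ∑ u ∈ S j, κ u y - 2 * ∑ u ∈ S t, κ u y)]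
    have := mul_le_mul_of_nonneg_left this (Nat.cast_nonneg (α := ℝ) m)
    simp only [D]; linarith
  have hDself : ∀ i, D i i = 0 := fun i => by simp [D]
  have hK : 0 ≤ K := by positivity
  let P : Finset (Finset I) :=
    univ.filter fun T => ∀ i ∈ T, ∀ j ∈ T, i ≠ j → K < D i j
  obtain ⟨T, hTP, hmax⟩ := P.exists_max_image Finset.card ⟨∅, by simp [P]⟩
  have hTsep : ∀ i ∈ T, ∀ j ∈ T, i ≠ j → K < D i j := (mem_filter.1 hTP).2
  have hnear : ∀ i, ∃ t : T, D i t ≤ K := by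
    intro i
    by_contra! hcon
    have hiT : i ∉ T := fun hi => by
      have := hcon ⟨i, hi⟩
      simp only [hDself] at this
      linarith
    have hins : insert i T ∈ P := by
      refine mem_filter.2 ⟨mem_univ _, fun x hx y hy hxy => ?_⟩
      rcases mem_insert.1 hx with rfl | hx'
      · rcases mem_insert.1 hy with rfl | hy'
        · exact absurd rfl hxy
        · exact hcon ⟨y, hy'⟩
      · rcases mem_insert.1 hy with rfl | hy'
        · rw [hDsymm]; exact hcon ⟨x, hx'⟩
        · exact hTsep x hx' y hy' hxy
    have := hmax _ hins
    rw [card_insert_of_notMem hiT] at this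
    omega
  choose c hc using hnear
  refine ⟨T, card_separated_le S κ h0 h1 m hm T hTsep, c, fun i j hij => ?_⟩
  have h1 := hDtri i j (c i)
  have h2 := hc i
  have h3 := hc j
  rw [← hij] at h3
  calc _ = D i j := rfl
    _ ≤ 4 * K := by linarith
    _ = _ := by simp only [K]; ring

/-- If every tuple with property `P` extends in at least `q` ways, there are many such tuples. -/
theorem pow_le_card_tuples {V : Type*} [Fintype V] [DecidableEq V] (q : ℝ) (hq : 0 ≤ q)
    (P : ∀ j : ℕ, (Fin j → V) → Prop) [∀ j, DecidablePred (P j)] (k : ℕ)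
    (hP0 : ∀ x, P 0 x)
    (hstep : ∀ j < k, ∀ x : Fin j → V, P j x →
      q ≤ (Finset.univ.filter fun v : V => P (j + 1) (Fin.cons v x)).card) :
    ∀ j ≤ k, q ^ j ≤ (Finset.univ.filter fun x : Fin j → V => P j x).card := by
  intro j
  induction j with
  | zero => intro _; simp [hP0]
  | succ j ih =>
    intro hj
    have hcard : (Finset.univ.filter fun x : Fin (j + 1) → V => P (j + 1) x).card
        = ∑ x : Fin j → V, (Finset.univ.filter fun v : V => P (j + 1) (Fin.cons v x)).card := by
      rw [Finset.card_filter, ← (Fin.consEquiv fun _ : Fin (j + 1) => V).sum_comp,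
        Fintype.sum_prod_type, Finset.sum_comm]
      simp only [Finset.card_filter]
      rfl
    rw [hcard, pow_succ]
    push_cast
    calc q ^ j * q ≤ (Finset.univ.filter fun x : Fin j → V => P j x).card * q :=
          mul_le_mul_of_nonneg_right (ih (by omega)) hq
      _ = ∑ x ∈ Finset.univ.filter (fun x : Fin j → V => P j x), q := by simp
      _ ≤ ∑ x ∈ Finset.univ.filter (fun x : Fin j → V => P j x),
          ((Finset.univ.filter fun v : V => P (j + 1) (Fin.cons v x)).card : ℝ) :=
          Finset.sum_le_sum fun x hx => hstep j (by omega) x (Finset.mem_filter.1 hx).2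
      _ ≤ _ := Finset.sum_le_sum_of_subset_of_nonneg (Finset.filter_subset _ _)
          fun _ _ _ => Nat.cast_nonneg _

namespace SimpleGraph

/-- A common neighbourhood of a `j`-clique contains no closed walk of length five. -/
theorem not_closed_five_walk {V : Type*} {G : SimpleGraph V} {j : ℕ}
    (hG : ALocallyBPartite G j 2) {v w u u' z : V}
    {h : Fin j → V} (hh : Pairwise fun i i' => G.Adj (h i) (h i'))
    (hv : ∀ i, G.Adj (h i) v) (hw : ∀ i, G.Adj (h i) w) (hu : ∀ i, G.Adj (h i) u)
    (hu' : ∀ i, G.Adj (h i) u') (hz : ∀ i, G.Adj (h i) z)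
    (hvw : G.Adj v w) (hvu : G.Adj v u) (huz : G.Adj u z) (hzu' : G.Adj z u')
    (hu'w : G.Adj u' w) : False := by
  classical
  have hinj : Function.Injective h := fun i i' hii => by
    by_contra hne
    exact (hh hne).ne hii
  have hclique : G.IsNClique j (Finset.univ.image h) := by
    constructor
    · intro x hx y hy hxy
      simp only [Finset.coe_image, Finset.coe_univ, Set.image_univ, Set.mem_range] at hx hy
      obtain ⟨i, rfl⟩ := hx
      obtain ⟨i', rfl⟩ := hy
      exact hh fun hii => hxy (congrArg h hii)
    · rw [Finset.card_image_of_injective _ hinj]; simp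
  obtain ⟨col⟩ := hG _ hclique
  have hmem : ∀ x, (∀ i, G.Adj (h i) x) →
      x ∈ {x | ∀ y ∈ Finset.univ.image h, G.Adj y x} := by
    intro x hx y hy
    obtain ⟨i, -, rfl⟩ := Finset.mem_image.1 hy
    exact hx i
  have e1 := col.valid (v := ⟨v, hmem v hv⟩) (w := ⟨w, hmem w hw⟩) hvw
  have e2 := col.valid (v := ⟨v, hmem v hv⟩) (w := ⟨u, hmem u hu⟩) hvu
  have e3 := col.valid (v := ⟨u, hmem u hu⟩) (w := ⟨z, hmem z hz⟩) huz
  have e4 := col.valid (v := ⟨z, hmem z hz⟩) (w := ⟨u', hmem u' hu'⟩) hzu'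
  have e5 := col.valid (v := ⟨u', hmem u' hu'⟩) (w := ⟨w, hmem w hw⟩) hu'w
  omega

variable {V : Type*} [Fintype V] [DecidableEq V] {G : SimpleGraph V} [DecidableRel G.Adj]

theorem card_commonNeighbors_ge {d : ℝ}
    (hdeg : ∀ v, d * (Fintype.card V : ℝ) ≤ G.degree v) (s : Finset V) :
    (1 - s.card * (1 - d)) * (Fintype.card V : ℝ)
      ≤ (Finset.univ.filter fun x => ∀ u ∈ s, G.Adj u x).card := by
  induction s using Finset.induction_on with
  | empty => simp
  | insert v s hv ih =>
    have hinter : (Finset.univ.filter fun x => ∀ u ∈ insert v s, G.Adj u x)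
        = G.neighborFinset v ∩ (Finset.univ.filter fun x => ∀ u ∈ s, G.Adj u x) := by
      ext x; simp
    have hie := Finset.card_union_add_card_inter (G.neighborFinset v)
      (Finset.univ.filter fun x => ∀ u ∈ s, G.Adj u x)
    have hun := Finset.card_le_univ (G.neighborFinset v ∪
      (Finset.univ.filter fun x => ∀ u ∈ s, G.Adj u x))
    rw [← hinter, G.card_neighborFinset_eq_degree] at hie
    have hie' : ((G.neighborFinset v ∪
      (Finset.univ.filter fun x => ∀ u ∈ s, G.Adj u x)).card : ℝ)
        + (Finset.univ.filter fun x => ∀ u ∈ insert v s, G.Adj u x).card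
        = G.degree v + (Finset.univ.filter fun x => ∀ u ∈ s, G.Adj u x).card := by
      exact_mod_cast hie
    have hun' : ((G.neighborFinset v ∪
      (Finset.univ.filter fun x => ∀ u ∈ s, G.Adj u x)).card : ℝ) ≤ Fintype.card V := by
      exact_mod_cast hun
    have := hdeg v
    rw [Finset.card_insert_of_notMem hv]
    push_cast
    linarith

variable (G) in
/-- The kernel recording whether `u` is adjacent to all of `y.1` and to `y.2`. -/
def starKernel (j : ℕ) (u : V) (y : (Fin j → V) × V) : ℝ :=
  if (∀ i, G.Adj u (y.1 i)) ∧ G.Adj u y.2 then 1 else 0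

/-- The two ends of an edge see rather different parts of the graph. -/
theorem le_sum_sq_of_adj {j : ℕ} (hG : ALocallyBPartite G j 2) {q : ℝ} (hq : 0 ≤ q)
    (hcommon : ∀ s : Finset V, s.card ≤ j + 1 →
      q ≤ (Finset.univ.filter fun x => ∀ u ∈ s, G.Adj u x).card) {v w : V} (hvw : G.Adj v w) :
    q ^ (2 * (j + 2)) ≤ (Fintype.card V : ℝ) ^ (j + 1) *
      ∑ y, (∑ u ∈ G.neighborFinset v, G.starKernel j u y
        - ∑ u ∈ G.neighborFinset w, G.starKernel j u y) ^ 2 := by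
  classical
  let P : ∀ i : ℕ, (Fin i → V) → Prop := fun i h =>
    (∀ l, G.Adj v (h l) ∧ G.Adj w (h l)) ∧ Pairwise fun l l' => G.Adj (h l) (h l')
  have hP : q ^ j ≤ (Finset.univ.filter fun h : Fin j → V => P j h).card := by
    refine pow_le_card_tuples q hq P j (fun x => ⟨fun l => l.elim0, fun l => l.elim0⟩) ?_ j le_rfl
    intro i hi h hh
    refine (hcommon (insert v (insert w (Finset.univ.image h))) ?_).trans ?_
    · have h1 := Finset.card_insert_le v (insert w (Finset.univ.image h))
      have h2 := Finset.card_insert_le w (Finset.univ.image h)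
      have h3 : (Finset.univ.image h).card ≤ i := Finset.card_image_le.trans (by simp)
      omega
    · norm_cast
      refine Finset.card_le_card fun x hx => ?_
      simp only [Finset.mem_filter, Finset.mem_univ, true_and, Finset.mem_insert,
        Finset.mem_image, forall_eq_or_imp, forall_exists_index, forall_apply_eq_imp_iff] at hx ⊢
      obtain ⟨hxv, hxw, hxh⟩ := hx
      refine ⟨fun l => ?_, fun l l' hll => ?_⟩
      · refine Fin.cases ⟨by simpa, by simpa⟩ (fun l => by simpa using hh.1 l) l
      · induction l using Fin.cases with
        | zero =>
          induction l' using Fin.cases with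
          | zero => exact absurd rfl hll
          | succ l' => simpa using (hxh l').symm
        | succ l =>
          induction l' using Fin.cases with
          | zero => simpa using hxh l
          | succ l' => simpa using hh.2 fun e => hll (congrArg Fin.succ e)
  let adm : Finset ((Fin j → V) × V) :=
    Finset.univ.filter fun y => P j y.1 ∧ ∀ i, G.Adj (y.1 i) y.2
  let F : V → (Fin j → V) × V → ℝ := fun x y => ∑ u ∈ G.neighborFinset x, G.starKernel j u y
  have hκ : ∀ u y, 0 ≤ G.starKernel j u y := fun u y => by
    unfold starKernel; split_ifs <;> norm_num
  have hF0 : ∀ x y, 0 ≤ F x y := fun x y => Finset.sum_nonneg fun u _ => hκ u y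
  have hex : ∀ x y, F x y ≠ 0 → ∃ u, G.Adj x u ∧ (∀ i, G.Adj u (y.1 i)) ∧ G.Adj u y.2 := by
    intro x y hne
    obtain ⟨u, hu, hne⟩ := Finset.exists_ne_zero_of_sum_ne_zero hne
    refine ⟨u, by simpa using hu, ?_⟩
    by_contra hcon
    exact hne (if_neg hcon)
  have hzero : ∀ y ∈ adm, F v y = 0 ∨ F w y = 0 := by
    intro y hy
    by_contra! hcon
    obtain ⟨⟨hyvw, hclq⟩, hyz⟩ := (Finset.mem_filter.1 hy).2
    obtain ⟨u, hvu, huh, huz⟩ := hex v y hcon.1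
    obtain ⟨u', hwu', hu'h, hu'z⟩ := hex w y hcon.2
    exact not_closed_five_walk hG hclq (fun i => (hyvw i).1.symm) (fun i => (hyvw i).2.symm)
      (fun i => (huh i).symm) (fun i => (hu'h i).symm) hyz hvw hvu huz hu'z.symm hwu'.symm
  have hsum : q ^ (j + 2) ≤ ∑ y ∈ adm, F v y := by
    have hadm : ∑ y ∈ adm, F v y = ∑ h ∈ Finset.univ.filter (fun h : Fin j → V => P j h),
        ∑ u ∈ G.neighborFinset v, ∑ z ∈ Finset.univ.filter (fun z => ∀ i, G.Adj (h i) z),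
          G.starKernel j u (h, z) := by
      rw [Finset.sum_finset_product adm (Finset.univ.filter fun h : Fin j → V => P j h)
        (fun h => Finset.univ.filter fun z => ∀ i, G.Adj (h i) z) (fun y => by simp [adm])]
      refine Finset.sum_congr rfl fun h _ => ?_
      rw [Finset.sum_comm]
    rw [hadm]
    have hinner : ∀ h : Fin j → V, ∀ u,
        u ∈ Finset.univ.filter (fun x => ∀ s ∈ insert v (Finset.univ.image h), G.Adj s x) →
        q ≤ ∑ z ∈ Finset.univ.filter (fun z => ∀ i, G.Adj (h i) z), G.starKernel j u (h, z) := by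
      intro h u hu
      simp only [Finset.mem_filter, Finset.mem_univ, true_and, Finset.mem_insert,
        Finset.mem_image, forall_eq_or_imp, forall_exists_index, forall_apply_eq_imp_iff] at hu
      refine (hcommon (insert u (Finset.univ.image h)) ?_).trans ?_
      · have h1 := Finset.card_insert_le u (Finset.univ.image h)
        have h3 : (Finset.univ.image h).card ≤ j := Finset.card_image_le.trans (by simp)
        omega
      · have hu2 : ∀ i, G.Adj u (h i) := fun i => (hu.2 i).symm
        simp only [starKernel, hu2, implies_true, true_and, Finset.sum_boole, Finset.filter_filter]
        norm_cast
        refine Finset.card_le_card fun x hx => ?_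
        simp only [Finset.mem_filter, Finset.mem_univ, true_and, Finset.mem_insert,
          Finset.mem_image, forall_eq_or_imp, forall_exists_index, forall_apply_eq_imp_iff] at hx ⊢
        exact ⟨hx.2, hx.1⟩
    have hmid : ∀ h : Fin j → V, q * q ≤ ∑ u ∈ G.neighborFinset v,
        ∑ z ∈ Finset.univ.filter (fun z => ∀ i, G.Adj (h i) z), G.starKernel j u (h, z) := by
      intro h
      have hc := hcommon (insert v (Finset.univ.image h)) (by
        have h1 := Finset.card_insert_le v (Finset.univ.image h)
        have h3 : (Finset.univ.image h).card ≤ j := Finset.card_image_le.trans (by simp)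
        omega)
      refine (mul_le_mul_of_nonneg_right hc hq).trans ?_
      rw [← nsmul_eq_mul]
      refine (Finset.card_nsmul_le_sum _ _ _ (hinner h)).trans ?_
      refine Finset.sum_le_sum_of_subset_of_nonneg (fun x hx => ?_)
        fun u _ _ => Finset.sum_nonneg fun z _ => hκ _ _
      simp only [Finset.mem_filter, Finset.mem_univ, true_and, Finset.mem_insert,
        forall_eq_or_imp] at hx
      simpa using hx.1
    calc q ^ (j + 2) = q ^ j * (q * q) := by ring
      _ ≤ (Finset.univ.filter fun h : Fin j → V => P j h).card * (q * q) :=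
        mul_le_mul_of_nonneg_right hP (mul_nonneg hq hq)
      _ ≤ _ := by
        rw [← nsmul_eq_mul]
        exact Finset.card_nsmul_le_sum _ _ _ fun h _ => hmid h
  have hcs : (∑ y ∈ adm, F v y) ^ 2 ≤ adm.card * ∑ y ∈ adm, F v y ^ 2 := sq_sum_le_card_mul_sum_sq
  have hadmcard : (adm.card : ℝ) ≤ (Fintype.card V : ℝ) ^ (j + 1) := by
    have := Finset.card_le_univ adm
    simp only [Fintype.card_prod, Fintype.card_fun, Fintype.card_fin, ← pow_succ] at this
    exact_mod_cast this
  have hD : ∑ y ∈ adm, F v y ^ 2 ≤ ∑ y, (F v y - F w y) ^ 2 := by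
    refine le_trans (Finset.sum_le_sum fun y hy => ?_)
      (Finset.sum_le_sum_of_subset_of_nonneg (Finset.subset_univ adm) fun _ _ _ => sq_nonneg _)
    rcases hzero y hy with h0 | h0
    · rw [h0]; nlinarith [sq_nonneg (F w y)]
    · rw [h0, sub_zero]
  calc q ^ (2 * (j + 2)) = (q ^ (j + 2)) ^ 2 := by rw [← pow_mul, mul_comm]
    _ ≤ (∑ y ∈ adm, F v y) ^ 2 := pow_le_pow_left₀ (pow_nonneg hq _) hsum 2
    _ ≤ _ := hcs
    _ ≤ _ := mul_le_mul hadmcard hD (Finset.sum_nonneg fun _ _ => sq_nonneg _) (by positivity)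

end SimpleGraph

/-- Above density `1 - 1 / (j + 1)`, graphs in which common neighbourhoods of `j`-cliques are
bipartite have bounded chromatic number. -/
theorem exists_colorable_of_locally_bipartite (j : ℕ) (d : ℝ)
    (hd : 1 - 1 / ((j : ℝ) + 1) < d) :
    ∃ C : ℕ, ∀ (V : Type) (_ : Fintype V) (G : SimpleGraph V) (_ : DecidableRel G.Adj),
      ALocallyBPartite G j 2 → d * (Fintype.card V : ℝ) ≤ (G.minDegree : ℝ) → G.Colorable C := by
  classical
  set η : ℝ := 1 - (j + 1) * (1 - d) with hη
  have hj : (0 : ℝ) < (j : ℝ) + 1 := by positivity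
  have hηpos : 0 < η := by
    have : 1 - d < 1 / ((j : ℝ) + 1) := by linarith
    rw [lt_div_iff₀ hj] at this
    rw [hη]; linarith
  obtain ⟨m, hm⟩ := exists_nat_gt (128 / η ^ (2 * (j + 2)))
  have hm0 : 0 < m := by
    have : (0 : ℝ) < m := lt_of_le_of_lt (by positivity) hm
    exact_mod_cast this
  rw [div_lt_iff₀ (by positivity)] at hm
  refine ⟨2 ^ (m + 1), fun V _ G _ hG hmin => ?_⟩
  rcases isEmpty_or_nonempty V with hV | hV
  · exact SimpleGraph.Colorable.of_isEmpty _
  set n : ℝ := (Fintype.card V : ℝ) with hn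
  have hnpos : 0 < n := by rw [hn]; exact_mod_cast Fintype.card_pos
  have hdeg : ∀ v, d * n ≤ G.degree v := fun v =>
    hmin.trans (by exact_mod_cast G.minDegree_le_degree v)
  have hd1 : d ≤ 1 := by
    obtain ⟨v⟩ := hV
    have h1 : (G.degree v : ℝ) ≤ n := by rw [hn]; exact_mod_cast (G.degree_lt_card_verts v).le
    have h2 := hdeg v
    by_contra! hc
    nlinarith
  have hcommon : ∀ s : Finset V, s.card ≤ j + 1 →
      η * n ≤ (Finset.univ.filter fun x => ∀ u ∈ s, G.Adj u x).card := by
    intro s hs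
    refine le_trans ?_ (G.card_commonNeighbors_ge hdeg s)
    refine mul_le_mul_of_nonneg_right ?_ hnpos.le
    have : (s.card : ℝ) ≤ j + 1 := by exact_mod_cast hs
    rw [hη]
    nlinarith
  obtain ⟨T, hT, c, hc⟩ := exists_similarity_classes (I := V) (fun v => G.neighborFinset v)
    (G.starKernel j) (fun u y => by unfold SimpleGraph.starKernel; split_ifs <;> norm_num)
    (fun u y => by unfold SimpleGraph.starKernel; split_ifs <;> norm_num) m hm0
  have hcol : G.Colorable T.card := by
    have := (SimpleGraph.Coloring.mk (G := G) c (fun {v w} hvw heq => ?_)).colorable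
    · simpa using this
    · have h1 := SimpleGraph.le_sum_sq_of_adj hG (mul_nonneg hηpos.le hnpos.le) hcommon hvw
      have h2 := hc v w heq
      have hY : (Fintype.card ((Fin j → V) × V) : ℝ) = n ^ (j + 1) := by
        simp [hn, pow_succ]
      rw [hY] at h2
      have h3 := mul_le_mul_of_nonneg_left h2 (by positivity : 0 ≤ n ^ (j + 1))
      have h4 := mul_le_mul_of_nonneg_left h1 (Nat.cast_nonneg (α := ℝ) m)
      have h5 : m * (η * n) ^ (2 * (j + 2)) ≤ 128 * n ^ (2 * (j + 2)) := by
        calc _ ≤ _ := h4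
          _ = _ := by rw [← hn]; ring
          _ ≤ _ := h3
          _ = _ := by rw [← hn]; ring
      have h6 : 0 < n ^ (2 * (j + 2)) := by positivity
      rw [mul_pow, ← mul_assoc] at h5
      exact absurd (le_of_mul_le_mul_right h5 h6) (not_le.2 hm)
  exact hcol.mono hT

/-- Shift graphs of strictly increasing tuples have unbounded chromatic number. -/
theorem exists_shift_monochromatic (r : ℕ) : ∀ c : ℕ, ∃ n : ℕ, ∀ (κ : Type) [Fintype κ],
    Fintype.card κ ≤ c → ∀ f : (Fin (r + 1) → Fin n) → κ,
      ∃ x : Fin (r + 2) → Fin n, StrictMono x ∧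
        f (fun i => x i.castSucc) = f (fun i => x i.succ) := by
  classical
  induction r with
  | zero =>
    intro c
    refine ⟨c + 1, fun κ _ hκ f => ?_⟩
    obtain ⟨s, t, hst, heq⟩ := Fintype.exists_ne_map_eq_of_card_lt
      (fun s : Fin (c + 1) => f fun _ => s) (by simpa using Nat.lt_succ_of_le hκ)
    wlog hlt : s < t generalizing s t
    · exact this t s hst.symm heq.symm (lt_of_le_of_ne (not_lt.1 hlt) hst.symm)
    refine ⟨![s, t], ?_, ?_⟩
    · rw [Fin.strictMono_iff_lt_succ]
      intro i
      fin_cases i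
      simpa using hlt
    · convert heq using 2
      all_goals
        funext i
        fin_cases i
        rfl
  | succ r ih =>
    intro c
    obtain ⟨n, hn⟩ := ih (2 ^ c)
    refine ⟨n, fun κ _ hκ f => ?_⟩
    let g : (Fin (r + 1) → Fin n) → Set κ := fun y =>
      {a | ∃ z : Fin (r + 2) → Fin n, StrictMono z ∧ (fun i : Fin (r + 1) => z i.castSucc) = y
        ∧ f z = a}
    obtain ⟨x, hx, hg⟩ := hn (Set κ)
      (by rw [Fintype.card_set]; exact Nat.pow_le_pow_right (by norm_num) hκ) g
    have hfx : f x ∈ g (fun i => x i.castSucc) := ⟨x, hx, rfl, rfl⟩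
    rw [hg] at hfx
    obtain ⟨z, hz, hzx, hfz⟩ := hfx
    refine ⟨Fin.cons (x 0) z, ?_, ?_⟩
    · rw [Fin.strictMono_iff_lt_succ]
      intro i
      induction i using Fin.cases with
      | zero =>
        have h0 := congrFun hzx 0
        simp only [Fin.castSucc_zero] at h0
        rw [Fin.castSucc_zero, Fin.cons_zero, Fin.cons_succ, h0]
        exact hx (Fin.succ_pos 0)
      | succ i =>
        rw [Fin.castSucc_succ, Fin.cons_succ, Fin.cons_succ]
        exact hz (Fin.castSucc_lt_succ)
    · have e1 : (fun i : Fin (r + 2) =>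
          (Fin.cons (x 0) z : Fin (r + 3) → Fin n) i.castSucc) = x := by
        funext i
        induction i using Fin.cases with
        | zero => simp
        | succ i =>
          rw [Fin.castSucc_succ, Fin.cons_succ]
          exact congrFun hzx i
      have e2 : (fun i : Fin (r + 2) =>
          (Fin.cons (x 0) z : Fin (r + 3) → Fin n) i.succ) = z := by
        funext i; simp
      rw [e1, e2, hfz]

/-- Position `p` carries the largest label of the tuple `w` under the labelling `π`. -/
def IsPeak {n r : ℕ} (π : Equiv.Perm (Fin n)) (w : Fin r → Fin n) (p : Fin r) : Prop :=
  ∀ q, π (w q) ≤ π (w p)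

theorem IsPeak.unique {n r : ℕ} {π : Equiv.Perm (Fin n)} {w : Fin r → Fin n}
    (hw : StrictMono w) {p q : Fin r} (hp : IsPeak π w p) (hq : IsPeak π w q) : p = q :=
  hw.injective (π.injective (le_antisymm (hq p) (hp q)))

theorem exists_isPeak {n r : ℕ} (π : Equiv.Perm (Fin n)) (w : Fin (r + 1) → Fin n) :
    ∃ p, IsPeak π w p :=
  Finite.exists_max fun q => π (w q)

open Classical in
/-- Each position is the peak for at most a `1 / r` fraction of the labellings. -/
theorem card_isPeak_le {n r : ℕ} (w : Fin r → Fin n) (hw : StrictMono w) (p : Fin r) :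
    r * (Finset.univ.filter fun π : Equiv.Perm (Fin n) => IsPeak π w p).card ≤ n.factorial := by
  have heq : ∀ q, (Finset.univ.filter fun π : Equiv.Perm (Fin n) => IsPeak π w q).card
      = (Finset.univ.filter fun π : Equiv.Perm (Fin n) => IsPeak π w p).card := by
    intro q
    have hswap : ∀ i, Equiv.swap (w p) (w q) (w i) = w (Equiv.swap p q i) := fun i =>
      (hw.injective.map_swap p q i).symm
    refine Finset.card_bij' (fun π _ => π * Equiv.swap (w p) (w q))
      (fun π _ => π * Equiv.swap (w p) (w q)) ?_ ?_ ?_ ?_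
    · intro π hπ
      refine Finset.mem_filter.2 ⟨Finset.mem_univ _, fun i => ?_⟩
      simpa [hswap] using (Finset.mem_filter.1 hπ).2 (Equiv.swap p q i)
    · intro π hπ
      refine Finset.mem_filter.2 ⟨Finset.mem_univ _, fun i => ?_⟩
      simpa [hswap] using (Finset.mem_filter.1 hπ).2 (Equiv.swap p q i)
    · intro π _; simp [mul_assoc]
    · intro π _; simp [mul_assoc]
  have hdisj : ((Finset.univ : Finset (Fin r)) : Set (Fin r)).PairwiseDisjoint
      fun q => Finset.univ.filter fun π : Equiv.Perm (Fin n) => IsPeak π w q := by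
    intro q _ q' _ hqq
    refine Finset.disjoint_left.2 fun π h1 h2 => hqq ?_
    exact IsPeak.unique hw (Finset.mem_filter.1 h1).2 (Finset.mem_filter.1 h2).2
  have hle := Finset.card_le_univ (Finset.univ.biUnion
    fun q => Finset.univ.filter fun π : Equiv.Perm (Fin n) => IsPeak π w q)
  rw [Finset.card_biUnion hdisj] at hle
  simpa [heq, Fintype.card_perm] using hle

/-- The labelling `π` peaks at an interior position of `w`. -/
def PeaksInside {n r : ℕ} (π : Equiv.Perm (Fin n)) (w : Fin (r + 1) → Fin n) : Prop :=
  ¬ IsPeak π w 0 ∧ ¬ IsPeak π w (Fin.last r)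

open Classical in
theorem le_card_peaksInside {n r : ℕ} (w : Fin (r + 1) → Fin n) (hw : StrictMono w) :
    (r + 1) * n.factorial ≤ (r + 1) * (Finset.univ.filter
      fun π : Equiv.Perm (Fin n) => PeaksInside π w).card + 2 * n.factorial := by
  have h0 := card_isPeak_le w hw 0
  have h1 := card_isPeak_le w hw (Fin.last r)
  have hcov : (Finset.univ : Finset (Equiv.Perm (Fin n)))
      ⊆ (Finset.univ.filter fun π : Equiv.Perm (Fin n) => PeaksInside π w)
        ∪ ((Finset.univ.filter fun π : Equiv.Perm (Fin n) => IsPeak π w 0)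
          ∪ Finset.univ.filter fun π : Equiv.Perm (Fin n) => IsPeak π w (Fin.last r)) := by
    intro π _
    simp only [Finset.mem_union, Finset.mem_filter, Finset.mem_univ, true_and]
    by_cases hz : IsPeak π w 0
    · exact Or.inr (Or.inl hz)
    · by_cases hl : IsPeak π w (Fin.last r)
      · exact Or.inr (Or.inr hl)
      · exact Or.inl ⟨hz, hl⟩
  have hc := (Finset.card_le_card hcov).trans (Finset.card_union_le _ _)
  have hc' := Finset.card_union_le
    (Finset.univ.filter fun π : Equiv.Perm (Fin n) => IsPeak π w 0)
    (Finset.univ.filter fun π : Equiv.Perm (Fin n) => IsPeak π w (Fin.last r))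
  rw [Finset.card_univ, Fintype.card_perm, Fintype.card_fin] at hc
  have := Nat.mul_le_mul_left (r + 1) (hc.trans (Nat.add_le_add_left hc' _))
  nlinarith

/-- Tuple `w'` is tuple `w` with its first entry dropped and a new last entry. -/
def IsShift {n r : ℕ} (w w' : Fin (r + 1) → Fin n) : Prop :=
  ∀ i : Fin r, w' i.castSucc = w i.succ

theorem IsShift.lt {n r : ℕ} {w w' : Fin (r + 2) → Fin n} (hw : StrictMono w)
    (h : IsShift w w') : w 0 < w' 0 := by
  have := h 0
  rw [Fin.castSucc_zero] at this
  rw [this]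
  exact hw (Fin.succ_pos 0)

theorem IsShift.not_trans {n r : ℕ} {w₁ w₂ w₃ : Fin (r + 2) → Fin n} (h2 : StrictMono w₂)
    (h12 : IsShift w₁ w₂) (h23 : IsShift w₂ w₃) (h13 : IsShift w₁ w₃) : False := by
  have e1 := h12 0
  have e2 := h13 0
  have := h23.lt h2
  rw [Fin.castSucc_zero] at e1 e2
  rw [e1, e2] at this
  exact lt_irrefl _ this

/-- Shifting a tuple moves an interior peak by one position. -/
theorem IsShift.peak_succ {n r : ℕ} {w w' : Fin (r + 1) → Fin n} {π : Equiv.Perm (Fin n)}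
    (hw : StrictMono w) (h : IsShift w w')
    (hin : PeaksInside π w) (hin' : PeaksInside π w') {p p' : Fin (r + 1)}
    (hp : IsPeak π w p) (hp' : IsPeak π w' p') : (p : ℕ) = p' + 1 := by
  obtain ⟨q, rfl⟩ := Fin.exists_succ_eq.2 fun h0 : p = 0 => hin.1 (h0 ▸ hp)
  obtain ⟨q', rfl⟩ := Fin.exists_castSucc_eq.2 fun h0 : p' = Fin.last r => hin'.2 (h0 ▸ hp')
  have h1 : π (w' q'.castSucc) ≤ π (w q.succ) := by
    rw [h q']; exact hp _
  have h2 : π (w q.succ) ≤ π (w' q'.castSucc) := by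
    rw [← h q]; exact hp' _
  have h3 := π.injective (le_antisymm h1 h2)
  rw [h q'] at h3
  have := hw.injective h3
  have := Fin.succ_injective _ this
  simp [this]

theorem IsShift.even_peak_iff {n r : ℕ} {w w' : Fin (r + 1) → Fin n} {π : Equiv.Perm (Fin n)}
    (hw : StrictMono w) (h : IsShift w w')
    (hin : PeaksInside π w) (hin' : PeaksInside π w') :
    (∃ p, IsPeak π w p ∧ Even (p : ℕ)) ↔ ¬ ∃ p, IsPeak π w' p ∧ Even (p : ℕ) := by
  obtain ⟨p, hp⟩ := exists_isPeak π w
  obtain ⟨p', hp'⟩ := exists_isPeak π w'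
  have hpp := h.peak_succ hw hin hin' hp hp'
  constructor
  · rintro ⟨q, hq, hqe⟩ ⟨q', hq', hqe'⟩
    rw [h.peak_succ hw hin hin' hq hq'] at hqe
    exact Nat.not_even_iff_odd.2 hqe'.add_one hqe
  · intro hno
    refine ⟨p, hp, ?_⟩
    rw [hpp]
    exact (Nat.not_even_iff_odd.1 fun he => hno ⟨p', hp', he⟩).add_one

/-- Vertices of `peakGraph`: increasing tuples, and `l + 1` parts indexed by labellings. -/
abbrev PeakVertex (n r l t : ℕ) : Type :=
  {w : Fin (r + 2) → Fin n // StrictMono w} ⊕ (Fin (l + 1) × Equiv.Perm (Fin n) × Fin t)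

/-- Adjacency in `peakGraph`. -/
def PeakAdj {n r l t : ℕ} : PeakVertex n r l t → PeakVertex n r l t → Prop
  | .inl w, .inl w' => IsShift w.1 w'.1 ∨ IsShift w'.1 w.1
  | .inl w, .inr p => p.1 ≠ 0 ∧ PeaksInside p.2.1 w.1
  | .inr p, .inl w => p.1 ≠ 0 ∧ PeaksInside p.2.1 w.1
  | .inr p, .inr q => p.1 ≠ q.1

/-- A shift graph together with a complete multipartite graph, in which a tuple is joined to the
labellings, outside the part `0`, that peak inside it. -/
def peakGraph (n r l t : ℕ) : SimpleGraph (PeakVertex n r l t) where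
  Adj := PeakAdj
  symm := ⟨by
    rintro (w | p) (w' | q) h
    · exact Or.symm h
    · exact h
    · exact h
    · exact Ne.symm h⟩
  loopless := ⟨by
    rintro (w | p) h
    · rcases h with h | h <;> exact lt_irrefl _ (h.lt w.2)
    · exact h rfl⟩

open Classical in
/-- A proper colouring of the neighbourhood of `v` in `peakGraph`. -/
noncomputable def peakColor {n r l t : ℕ} : PeakVertex n r l t → PeakVertex n r l t → Fin (l + 1)
  | .inl _, .inl _ => 0
  | .inr p, .inl w => if ∃ i, IsPeak p.2.1 w.1 i ∧ Even (i : ℕ) then 0 else p.1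
  | _, .inr q => q.1

theorem peakColor_ne {n r l t : ℕ} {v x y : PeakVertex n r l t}
    (hvx : (peakGraph n r l t).Adj v x) (hvy : (peakGraph n r l t).Adj v y)
    (hxy : (peakGraph n r l t).Adj x y) : peakColor v x ≠ peakColor v y := by
  rcases v with v | p <;> rcases x with x | q <;> rcases y with y | q'
  · exfalso
    rcases hvx with hvx | hvx <;> rcases hvy with hvy | hvy <;> rcases hxy with hxy | hxy
    · exact IsShift.not_trans x.2 hvx hxy hvy
    · exact IsShift.not_trans y.2 hvy hxy hvx
    · exact lt_asymm ((hvx.lt v.2).trans (hxy.lt x.2)) (hvy.lt y.2)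
    · exact IsShift.not_trans v.2 hvy hvx hxy
    · exact IsShift.not_trans v.2 hvx hvy hxy
    · exact lt_asymm ((hvy.lt v.2).trans (hxy.lt y.2)) (hvx.lt x.2)
    · exact IsShift.not_trans y.2 hxy hvy hvx
    · exact IsShift.not_trans x.2 hxy hvx hvy
  · exact hxy.1.symm
  · exact hxy.1
  · exact hxy
  · obtain ⟨hp, hx⟩ := hvx
    obtain ⟨-, hy⟩ := hvy
    rcases hxy with hxy | hxy
    · have := hxy.even_peak_iff x.2 hx hy
      by_cases he : ∃ i, IsPeak p.2.1 y.1 i ∧ Even (i : ℕ)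
      · have hx' := fun h => this.1 h he
        simp only [peakColor, if_pos he, if_neg hx']
        exact hp
      · simp only [peakColor, if_neg he, if_pos (this.2 he)]
        exact hp.symm
    · have := hxy.even_peak_iff y.2 hy hx
      by_cases he : ∃ i, IsPeak p.2.1 x.1 i ∧ Even (i : ℕ)
      · have hy' := fun h => this.1 h he
        simp only [peakColor, if_pos he, if_neg hy']
        exact hp.symm
      · simp only [peakColor, if_neg he, if_pos (this.2 he)]
        exact hp
  · simp only [peakColor]
    split_ifs
    · exact hxy.1.symm
    · exact hvy
  · simp only [peakColor]
    split_ifs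
    · exact hxy.1
    · exact Ne.symm hvx
  · exact hxy

theorem aLocallyBPartite_peakGraph (n r l t : ℕ) :
    ALocallyBPartite (peakGraph n r l t) 1 (l + 1) := by
  intro s hs
  obtain ⟨v, rfl⟩ := Finset.card_eq_one.1 hs.card_eq
  refine ⟨SimpleGraph.Coloring.mk (fun x => peakColor v x.1) ?_⟩
  intro x y hxy
  exact peakColor_ne (x.2 v (Finset.mem_singleton_self v)) (y.2 v (Finset.mem_singleton_self v)) hxy

open Classical in
theorem degree_peakGraph_ge (n r l t : ℕ) (v : PeakVertex n r l t) :
    l * ((r : ℝ) / (r + 2) * n.factorial * t) ≤ (peakGraph n r l t).degree v := by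
  have hr : (0 : ℝ) < (r : ℝ) + 2 := by positivity
  rw [← SimpleGraph.card_neighborFinset_eq_degree]
  rcases v with w | p
  · have hsub : ((Finset.univ.erase (0 : Fin (l + 1))) ×ˢ
        ((Finset.univ.filter fun π : Equiv.Perm (Fin n) => PeaksInside π w.1) ×ˢ
          (Finset.univ : Finset (Fin t)))).map Function.Embedding.inr
        ⊆ (peakGraph n r l t).neighborFinset (.inl w) := by
      intro x hx
      obtain ⟨q, hq, rfl⟩ := Finset.mem_map.1 hx
      have hq1 := Finset.mem_product.1 hq
      have hq2 := Finset.mem_product.1 hq1.2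
      rw [SimpleGraph.mem_neighborFinset]
      exact ⟨Finset.ne_of_mem_erase hq1.1, (Finset.mem_filter.1 hq2.1).2⟩
    have hcard := Finset.card_le_card hsub
    rw [Finset.card_map, Finset.card_product, Finset.card_product,
      Finset.card_erase_of_mem (Finset.mem_univ _)] at hcard
    simp only [Finset.card_univ, Fintype.card_fin, Nat.add_sub_cancel] at hcard
    have hpk := le_card_peaksInside w.1 w.2
    have hpk' : (r : ℝ) / (r + 2) * n.factorial ≤
        (Finset.univ.filter fun π : Equiv.Perm (Fin n) => PeaksInside π w.1).card := by
      rw [div_mul_eq_mul_div, div_le_iff₀ hr]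
      have : ((r + 1 + 1 : ℕ) * n.factorial : ℝ) ≤ (r + 1 + 1 : ℕ) * (Finset.univ.filter
        fun π : Equiv.Perm (Fin n) => PeaksInside π w.1).card + 2 * n.factorial := by
        exact_mod_cast hpk
      push_cast at this
      linarith
    refine le_trans ?_ (Nat.cast_le.2 hcard)
    push_cast
    gcongr
  · have hsub : ((Finset.univ.erase p.1) ×ˢ
        (Finset.univ : Finset (Equiv.Perm (Fin n) × Fin t))).map Function.Embedding.inr
        ⊆ (peakGraph n r l t).neighborFinset (.inr p) := by
      intro x hx
      obtain ⟨q, hq, rfl⟩ := Finset.mem_map.1 hx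
      rw [SimpleGraph.mem_neighborFinset]
      exact (Finset.ne_of_mem_erase (Finset.mem_product.1 hq).1).symm
    have hcard := Finset.card_le_card hsub
    rw [Finset.card_map, Finset.card_product,
      Finset.card_erase_of_mem (Finset.mem_univ _)] at hcard
    simp only [Finset.card_univ, Fintype.card_fin, Nat.add_sub_cancel, Fintype.card_prod,
      Fintype.card_perm] at hcard
    refine le_trans ?_ (Nat.cast_le.2 hcard)
    push_cast
    have : (r : ℝ) / (r + 2) ≤ 1 := by rw [div_le_one hr]; linarith
    have h2 : (r : ℝ) / (r + 2) * n.factorial ≤ n.factorial :=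
      mul_le_of_le_one_left (Nat.cast_nonneg _) this
    gcongr

theorem not_colorable_peakGraph {n r l t c : ℕ}
    (hn : ∀ f : (Fin (r + 2) → Fin n) → Option (Fin c), ∃ x : Fin (r + 3) → Fin n,
      StrictMono x ∧ f (fun i => x i.castSucc) = f (fun i => x i.succ)) :
    ¬ (peakGraph n r l t).Colorable c := by
  classical
  rintro ⟨col⟩
  obtain ⟨x, hx, heq⟩ := hn fun w => if hw : StrictMono w then some (col (.inl ⟨w, hw⟩)) else none
  have h1 : StrictMono fun i : Fin (r + 2) => x i.castSucc :=
    fun i j hij => hx (Fin.castSucc_lt_castSucc_iff.2 hij)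
  have h2 : StrictMono fun i : Fin (r + 2) => x i.succ :=
    fun i j hij => hx (Fin.succ_lt_succ_iff.2 hij)
  rw [dif_pos h1, dif_pos h2] at heq
  refine col.valid (v := .inl ⟨_, h1⟩) (w := .inl ⟨_, h2⟩) (Or.inl fun i => ?_)
    (Option.some_injective _ heq)
  simp

/-- Below density `1 - 1 / (l + 1)`, locally `(l + 1)`-partite graphs have unbounded chromatic
number. -/
theorem exists_not_colorable_locally_partite (l : ℕ) (d : ℝ)
    (hd : d < 1 - 1 / ((l : ℝ) + 1)) (C : ℕ) :
    ∃ (V : Type) (_ : Fintype V) (G : SimpleGraph V) (_ : DecidableRel G.Adj),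
      ALocallyBPartite G 1 (l + 1) ∧ d * (Fintype.card V : ℝ) ≤ (G.minDegree : ℝ) ∧
        ¬ G.Colorable C := by
  classical
  have hl : (0 : ℝ) < (l : ℝ) + 1 := by positivity
  have hgap : 0 < l - d * (l + 1) := by
    have : d * (l + 1) < (1 - 1 / ((l : ℝ) + 1)) * (l + 1) := mul_lt_mul_of_pos_right hd hl
    rw [sub_mul, div_mul_cancel₀ _ hl.ne'] at this
    linarith
  set β : ℝ := (l - d * (l + 1)) / 2 with hβ
  have hβpos : 0 < β := by positivity
  obtain ⟨r, hr⟩ := exists_nat_gt (2 * l / β)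
  rw [div_lt_iff₀ hβpos] at hr
  have hr2 : (0 : ℝ) < (r : ℝ) + 2 := by positivity
  have hratio : d * (l + 1) + β ≤ l * ((r : ℝ) / (r + 2)) := by
    have h1 : (l : ℝ) * ((r : ℝ) / (r + 2)) = l - 2 * l / (r + 2) := by
      field_simp
      ring
    have h2 : 2 * (l : ℝ) / (r + 2) ≤ β := by
      rw [div_le_iff₀ hr2]; nlinarith
    rw [h1]
    linarith
  obtain ⟨n, hn⟩ := exists_shift_monochromatic (r + 1) (C + 1)
  set ω : ℝ := (Fintype.card {w : Fin (r + 2) → Fin n // StrictMono w} : ℝ) with hω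
  obtain ⟨t, ht⟩ := exists_nat_gt (|d| * ω / β)
  have ht0 : 0 < t := by
    have : (0 : ℝ) < t := lt_of_le_of_lt (by positivity) ht
    exact_mod_cast this
  rw [div_lt_iff₀ hβpos] at ht
  have : Nonempty (Fin t) := ⟨⟨0, ht0⟩⟩
  refine ⟨PeakVertex n r l t, inferInstance, peakGraph n r l t, inferInstance,
    aLocallyBPartite_peakGraph n r l t, ?_,
    not_colorable_peakGraph (hn (Option (Fin C)) (by simp))⟩
  obtain ⟨v, hv⟩ := (peakGraph n r l t).exists_minimal_degree_vertex
  rw [hv]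
  refine le_trans ?_ (degree_peakGraph_ge n r l t v)
  have hcard : (Fintype.card (PeakVertex n r l t) : ℝ) = ω + (l + 1) * (n.factorial * t) := by
    rw [hω]
    simp [Fintype.card_sum, Fintype.card_prod, Fintype.card_perm]
  rw [hcard]
  have hfac : (1 : ℝ) ≤ n.factorial := by exact_mod_cast n.factorial_pos
  have htpos : (0 : ℝ) < t := by exact_mod_cast ht0
  have h1 : d * ω ≤ |d| * ω := mul_le_mul_of_nonneg_right (le_abs_self d) (by positivity)
  have h2 : t * β ≤ n.factorial * (t * β) := le_mul_of_one_le_left (by positivity) hfac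
  have h3 := mul_le_mul_of_nonneg_right hratio (by positivity : (0 : ℝ) ≤ n.factorial * t)
  nlinarith

/-- For positive integers `a` and `b ≥ 2`, the chromatic threshold of the
family of `a`-locally `b`-partite graphs is `1 − 1/(a + b − 1)`: (i) for every
`d > 1 − 1/(a+b−1)` there is `C` such that every `a`-locally `b`-partite graph with
`δ(G) ≥ d·|G|` is `C`-colourable; (ii) for every `d < 1 − 1/(a+b−1)` and every `C` there is
an `a`-locally `b`-partite graph with `δ(G) ≥ d·|G|` and chromatic number exceeding `C`. -/
theorem stmt_10 (a b : ℕ) (ha : 1 ≤ a) (hb : 2 ≤ b) :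
    (∀ d : ℝ, 1 - 1 / ((a : ℝ) + (b : ℝ) - 1) < d → ∃ C : ℕ,
      ∀ (V : Type) (instV : Fintype V) (G : SimpleGraph V) (instG : DecidableRel G.Adj),
        ALocallyBPartite G a b →
        d * (Fintype.card V : ℝ) ≤ ((@SimpleGraph.minDegree V G instV instG : ℕ) : ℝ) →
        G.Colorable C) ∧
    (∀ d : ℝ, d < 1 - 1 / ((a : ℝ) + (b : ℝ) - 1) → ∀ C : ℕ,
      ∃ (V : Type) (instV : Fintype V) (G : SimpleGraph V) (instG : DecidableRel G.Adj),
        ALocallyBPartite G a b ∧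
        d * (Fintype.card V : ℝ) ≤ ((@SimpleGraph.minDegree V G instV instG : ℕ) : ℝ) ∧
        ¬ G.Colorable C) := by
  obtain ⟨a, rfl⟩ : ∃ a', a = a' + 1 := ⟨a - 1, by omega⟩
  obtain ⟨b, rfl⟩ : ∃ b', b = b' + 2 := ⟨b - 2, by omega⟩
  have hdens : ((a + 1 : ℕ) : ℝ) + ((b + 2 : ℕ) : ℝ) - 1 = ((a + 1 + b : ℕ) : ℝ) + 1 := by
    push_cast; ring
  rw [hdens]
  refine ⟨fun d hd => ?_, fun d hd C => ?_⟩
  · obtain ⟨C, hC⟩ := exists_colorable_of_locally_bipartite (a + 1 + b) d hd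
    refine ⟨C, fun V _ G _ hG hmin => hC V _ G _ ?_ hmin⟩
    rw [Nat.add_comm b 2] at hG
    exact hG.add_left b
  · obtain ⟨V, _, G, _, hG, hmin, hcol⟩ := exists_not_colorable_locally_partite (a + 1 + b) d hd C
    refine ⟨V, _, G, _, ?_, hmin, hcol⟩
    rw [show a + 1 + b + 1 = b + 2 + a by omega] at hG
    rw [Nat.add_comm a 1]
    exact hG.add_left a
end

section
/- Let G be a locally bipartite graph containing a copy of the Moser spindle H₀, with δ(G) > |G|/2. Then G contains a copy of H₁, where H₁ is H₀ plus one additional edge: vertices a₀,…,a₆ with edges a₀a₁, a₁a₂, a₂a₃, a₃a₄, a₄a₅, a₅a₆, a₆a₀, a₃a₅, a₅a₀, a₀a₂, a₂a₄, a₆a₁. -/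
/-- The Moser spindle `H₀`: vertices `a₀,…,a₆` with edges
`a₀a₁, a₁a₂, a₂a₃, a₃a₄, a₄a₅, a₅a₆, a₆a₀, a₅a₀, a₀a₂, a₁a₃, a₄a₆`. -/
def MoserSpindle : SimpleGraph (Fin 7) :=
  SimpleGraph.fromRel (fun i j => (i, j) ∈
    ([(0, 1), (1, 2), (2, 3), (3, 4), (4, 5), (5, 6), (6, 0), (5, 0), (0, 2), (1, 3), (4, 6)] :
      List (Fin 7 × Fin 7)))

/-- The graph `H₁`: vertices `a₀,…,a₆` with edges
`a₀a₁, a₁a₂, a₂a₃, a₃a₄, a₄a₅, a₅a₆, a₆a₀, a₃a₅, a₅a₀, a₀a₂, a₂a₄, a₆a₁`. -/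
def GraphH1 : SimpleGraph (Fin 7) :=
  SimpleGraph.fromRel (fun i j => (i, j) ∈
    ([(0, 1), (1, 2), (2, 3), (3, 4), (4, 5), (5, 6), (6, 0), (3, 5), (5, 0), (0, 2), (2, 4),
      (6, 1)] : List (Fin 7 × Fin 7)))

/-- `G` contains a (not necessarily induced) copy of `H`. -/
def ContainsCopy {V : Type*} (H : SimpleGraph (Fin 7)) (G : SimpleGraph V) : Prop :=
  ∃ f : Fin 7 → V, Function.Injective f ∧ ∀ i j, H.Adj i j → G.Adj (f i) (f j)

/-- In a locally bipartite graph no triangle lies in a neighbourhood. -/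
theorem not_adj_triangle {V : Type*} {G : SimpleGraph V}
    (hloc : ∀ v : V, (G.induce (G.neighborSet v)).Colorable 2) {c p q r : V}
    (hp : G.Adj c p) (hq : G.Adj c q) (hr : G.Adj c r)
    (hpq : G.Adj p q) (hqr : G.Adj q r) (hrp : G.Adj r p) : False := by
  obtain ⟨C⟩ := hloc c
  have key : ∀ x y (hx : G.Adj c x) (hy : G.Adj c y), G.Adj x y →
      C ⟨x, hx⟩ ≠ C ⟨y, hy⟩ := fun x y hx hy h => C.valid h
  have h₁ := key p q hp hq hpq
  have h₂ := key q r hq hr hqr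
  have h₃ := key r p hr hp hrp
  omega

/-- In a locally bipartite graph no closed walk of length five lies in a neighbourhood. -/
theorem not_adj_pentagon {V : Type*} {G : SimpleGraph V}
    (hloc : ∀ v : V, (G.induce (G.neighborSet v)).Colorable 2) {c p q r s t : V}
    (hp : G.Adj c p) (hq : G.Adj c q) (hr : G.Adj c r) (hs : G.Adj c s) (ht : G.Adj c t)
    (hpq : G.Adj p q) (hqr : G.Adj q r) (hrs : G.Adj r s) (hst : G.Adj s t)
    (htp : G.Adj t p) : False := by
  obtain ⟨C⟩ := hloc c
  have key : ∀ x y (hx : G.Adj c x) (hy : G.Adj c y), G.Adj x y →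
      C ⟨x, hx⟩ ≠ C ⟨y, hy⟩ := fun x y hx hy h => C.valid h
  have h₁ := key p q hp hq hpq
  have h₂ := key q r hq hr hqr
  have h₃ := key r s hr hs hrs
  have h₄ := key s t hs ht hst
  have h₅ := key t p ht hp htp
  omega

/-- In a locally bipartite graph every homomorphic image of `GraphH1` is a copy of it. -/
theorem containsCopy_graphH1_of_adj {V : Type*} {G : SimpleGraph V}
    (hloc : ∀ v : V, (G.induce (G.neighborSet v)).Colorable 2) {a₀ a₁ a₂ a₃ a₄ a₅ a₆ : V}
    (h01 : G.Adj a₀ a₁) (h12 : G.Adj a₁ a₂) (h23 : G.Adj a₂ a₃) (h34 : G.Adj a₃ a₄)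
    (h45 : G.Adj a₄ a₅) (h56 : G.Adj a₅ a₆) (h60 : G.Adj a₆ a₀) (h35 : G.Adj a₃ a₅)
    (h50 : G.Adj a₅ a₀) (h02 : G.Adj a₀ a₂) (h24 : G.Adj a₂ a₄) (h61 : G.Adj a₆ a₁) :
    ContainsCopy GraphH1 G := by
  have n03 : a₀ ≠ a₃ := by
    rintro rfl
    exact not_adj_pentagon hloc h01 h02 h34 h50.symm h60.symm h12 h24 h45 h56 h61
  have n13 : a₁ ≠ a₃ := by
    rintro rfl
    exact not_adj_triangle hloc h01 h50.symm h60.symm h35 h56 h61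
  have n04 : a₀ ≠ a₄ := by
    rintro rfl
    exact not_adj_pentagon hloc h01 h02 h34.symm h45 h60.symm h12 h23 h35 h56 h61
  have n14 : a₁ ≠ a₄ := by
    rintro rfl
    exact not_adj_triangle hloc h01 h50.symm h60.symm h45 h56 h61
  have n15 : a₁ ≠ a₅ := by
    rintro rfl
    exact not_adj_triangle hloc h12 h35.symm h45.symm h23 h34 h24.symm
  have n25 : a₂ ≠ a₅ := by
    rintro rfl
    exact not_adj_triangle hloc h01 h02 h60.symm h12 h56 h61
  have n26 : a₂ ≠ a₆ := by
    rintro rfl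
    exact not_adj_triangle hloc h23 h24 h56.symm h34 h45 h35.symm
  have n36 : a₃ ≠ a₆ := by
    rintro rfl
    exact not_adj_triangle hloc h01 h02 h60.symm h12 h23 h61
  have n46 : a₄ ≠ a₆ := by
    rintro rfl
    exact not_adj_triangle hloc h01 h02 h60.symm h12 h24 h61
  refine ⟨![a₀, a₁, a₂, a₃, a₄, a₅, a₆], ?_, ?_⟩
  · rw [← List.nodup_ofFn]
    simp [h01.ne, h12.ne, h23.ne, h34.ne, h45.ne, h56.ne, h60.ne', h35.ne, h50.ne', h02.ne,
      h24.ne, h61.ne', n03, n13, n04, n14, n15, n25, n26, n36, n46]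
  · intro i j
    fin_cases i <;> fin_cases j <;> simp [GraphH1, h01, h12, h23, h34, h45, h56, h60, h35, h50,
      h02, h24, h61, h01.symm, h12.symm, h23.symm, h34.symm, h45.symm, h56.symm, h60.symm,
      h35.symm, h50.symm, h02.symm, h24.symm, h61.symm]

/-- If all degrees exceed half the order, every sequence of vertices has more than half of its
terms in a common neighbourhood. -/
theorem exists_lt_two_mul_sum_adj {V : Type*} [Fintype V] (G : SimpleGraph V)
    [DecidableRel G.Adj] (hδ : 2 * G.minDegree > Fintype.card V) {m : ℕ} (hm : 0 < m)
    (x : Fin m → V) : ∃ v, m < 2 * ∑ i, if G.Adj v (x i) then 1 else 0 := by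
  by_contra! h
  have h₁ : ∑ v, 2 * ∑ i, (if G.Adj v (x i) then 1 else 0) ≤ ∑ _v : V, m :=
    Finset.sum_le_sum fun v _ => h v
  have h₂ : ∑ v, ∑ i, (if G.Adj v (x i) then 1 else 0) = ∑ i, G.degree (x i) := by
    rw [Finset.sum_comm]
    refine Finset.sum_congr rfl fun i _ => ?_
    rw [← G.card_neighborFinset_eq_degree, G.neighborFinset_eq_filter, Finset.card_filter]
    simp only [G.adj_comm]
  have h₃ : ∑ _i : Fin m, G.minDegree ≤ ∑ i, G.degree (x i) :=
    Finset.sum_le_sum fun i _ => G.minDegree_le_degree _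
  rw [← Finset.mul_sum, h₂] at h₁
  simp only [Finset.sum_const, Finset.card_univ, Fintype.card_fin, smul_eq_mul] at h₁ h₃
  nlinarith

/-- A square of a path on seven vertices with adjacent ends yields a copy of `GraphH1`. -/
theorem containsCopy_graphH1_of_pathSquare {V : Type*} [Fintype V] {G : SimpleGraph V}
    [DecidableRel G.Adj] (hloc : ∀ v : V, (G.induce (G.neighborSet v)).Colorable 2)
    (hδ : 2 * G.minDegree > Fintype.card V) {x₀ x₁ x₂ x₃ x₄ x₅ x₆ : V}
    (h01 : G.Adj x₀ x₁) (h12 : G.Adj x₁ x₂) (h23 : G.Adj x₂ x₃) (h34 : G.Adj x₃ x₄)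
    (h45 : G.Adj x₄ x₅) (h56 : G.Adj x₅ x₆) (h02 : G.Adj x₀ x₂) (h13 : G.Adj x₁ x₃)
    (h24 : G.Adj x₂ x₄) (h35 : G.Adj x₃ x₅) (h46 : G.Adj x₄ x₆) (h06 : G.Adj x₀ x₆) :
    ContainsCopy GraphH1 G := by
  obtain ⟨v, hv⟩ := exists_lt_two_mul_sum_adj G hδ (by norm_num) ![x₀, x₂, x₄, x₆]
  simp only [Fin.sum_univ_four, Matrix.cons_val] at hv
  have c024 (h₀ : G.Adj v x₀) (h₂ : G.Adj v x₂) (h₄ : G.Adj v x₄) : False :=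
    not_adj_pentagon hloc h₂.symm h02.symm h12.symm h23 h24 h₀ h01 h13 h34 h₄.symm
  have c246 (h₂ : G.Adj v x₂) (h₄ : G.Adj v x₄) (h₆ : G.Adj v x₆) : False :=
    not_adj_pentagon hloc h₄.symm h46 h45 h34.symm h24.symm h₆ h56.symm h35.symm h23.symm h₂.symm
  have c026 (h₀ : G.Adj v x₀) (h₂ : G.Adj v x₂) (h₆ : G.Adj v x₆) :
      ContainsCopy GraphH1 G :=
    containsCopy_graphH1_of_adj hloc (a₀ := x₄) (a₁ := x₃) (a₂ := x₂) (a₃ := x₀) (a₄ := v)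
      (a₅ := x₆) (a₆ := x₅) h34.symm h23.symm h02.symm h₀.symm h₆ h56.symm h45.symm h06
      h46.symm h24.symm h₂.symm h35.symm
  have c046 (h₀ : G.Adj v x₀) (h₄ : G.Adj v x₄) (h₆ : G.Adj v x₆) :
      ContainsCopy GraphH1 G :=
    containsCopy_graphH1_of_adj hloc (a₀ := x₂) (a₁ := x₁) (a₂ := x₀) (a₃ := x₆) (a₄ := v)
      (a₅ := x₄) (a₆ := x₃) h12.symm h01.symm h06 h₆.symm h₄ h34.symm h23.symm h46.symm
      h24.symm h02.symm h₀.symm h13.symm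
  grind

/-- A spindle with apex `a`, diamonds `a, b, c, d` and `a, e, f, g`, and edge `d g`, together with
a common neighbour of `a`, `b`, `d` and `g`, yields a copy of `GraphH1`. -/
theorem containsCopy_graphH1_of_adj_both_tips {V : Type*} {G : SimpleGraph V}
    (hloc : ∀ v : V, (G.induce (G.neighborSet v)).Colorable 2) {a b d e f g v : V}
    (hab : G.Adj a b) (hbd : G.Adj b d) (hae : G.Adj a e) (haf : G.Adj a f) (hef : G.Adj e f)
    (heg : G.Adj e g) (hfg : G.Adj f g) (hdg : G.Adj d g)
    (hva : G.Adj v a) (hvb : G.Adj v b) (hvd : G.Adj v d) (hvg : G.Adj v g) :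
    ContainsCopy GraphH1 G :=
  containsCopy_graphH1_of_adj hloc (a₀ := v) (a₁ := b) (a₂ := a) (a₃ := e) (a₄ := f) (a₅ := g)
    (a₆ := d) hvb hab.symm hae hef hfg hdg.symm hvd.symm heg hvg.symm hva haf hbd.symm

/-- A homomorphic image of the Moser spindle with apex `a` yields a copy of `GraphH1` when all
degrees exceed half the order. -/
theorem containsCopy_graphH1_of_spindle {V : Type*} [Fintype V] {G : SimpleGraph V}
    [DecidableRel G.Adj] (hloc : ∀ v : V, (G.induce (G.neighborSet v)).Colorable 2)
    (hδ : 2 * G.minDegree > Fintype.card V) {a b c d e f g : V}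
    (hab : G.Adj a b) (hac : G.Adj a c) (hbc : G.Adj b c) (hbd : G.Adj b d) (hcd : G.Adj c d)
    (hae : G.Adj a e) (haf : G.Adj a f) (hef : G.Adj e f) (heg : G.Adj e g) (hfg : G.Adj f g)
    (hdg : G.Adj d g) : ContainsCopy GraphH1 G := by
  obtain ⟨v, hv⟩ := exists_lt_two_mul_sum_adj G hδ (by norm_num) ![a, a, b, c, d, e, f, g]
  simp only [Fin.sum_univ_eight, Matrix.cons_val] at hv
  have two_tips {b : V} (hab : G.Adj a b) (hbd : G.Adj b d) (hva : G.Adj v a)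
      (hvb : G.Adj v b) (hvd : G.Adj v d) (hvg : G.Adj v g) : ContainsCopy GraphH1 G :=
    containsCopy_graphH1_of_adj_both_tips hloc hab hbd hae haf hef heg hfg hdg hva hvb hvd hvg
  have two_tips' {e : V} (hae : G.Adj a e) (heg : G.Adj e g) (hva : G.Adj v a)
      (hve : G.Adj v e) (hvd : G.Adj v d) (hvg : G.Adj v g) : ContainsCopy GraphH1 G :=
    containsCopy_graphH1_of_adj_both_tips hloc hae heg hab hac hbc hbd hcd hdg.symm hva hve hvg hvd
  have one_tip {b e f d g : V} (hab : G.Adj a b) (hbd : G.Adj b d) (hae : G.Adj a e)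
      (haf : G.Adj a f) (hef : G.Adj e f) (heg : G.Adj e g) (hfg : G.Adj f g) (hdg : G.Adj d g)
      (hva : G.Adj v a) (hvb : G.Adj v b) (hvd : G.Adj v d) (hve : G.Adj v e) :
      ContainsCopy GraphH1 G :=
    containsCopy_graphH1_of_pathSquare hloc hδ hbd.symm hvb.symm hva hae hef hfg hvd.symm
      hab.symm hve haf heg hdg
  have abc (h₁ : G.Adj v a) (h₂ : G.Adj v b) (h₃ : G.Adj v c) : False :=
    not_adj_triangle hloc h₁ h₂ h₃ hab hbc hac.symm
  have dbc (h₁ : G.Adj v d) (h₂ : G.Adj v b) (h₃ : G.Adj v c) : False :=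
    not_adj_triangle hloc h₁ h₂ h₃ hbd.symm hbc hcd
  have aef (h₁ : G.Adj v a) (h₂ : G.Adj v e) (h₃ : G.Adj v f) : False :=
    not_adj_triangle hloc h₁ h₂ h₃ hae hef haf.symm
  have gef (h₁ : G.Adj v g) (h₂ : G.Adj v e) (h₃ : G.Adj v f) : False :=
    not_adj_triangle hloc h₁ h₂ h₃ heg.symm hef hfg
  have tb := two_tips hab hbd
  have tc := two_tips hac hcd
  have te := two_tips' hae heg
  have tf := two_tips' haf hfg
  have dbe := one_tip hab hbd hae haf hef heg hfg hdg
  have dbf := one_tip hab hbd haf hae hef.symm hfg heg hdg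
  have dce := one_tip hac hcd hae haf hef heg hfg hdg
  have dcf := one_tip hac hcd haf hae hef.symm hfg heg hdg
  have geb := one_tip hae heg hab hac hbc hbd hcd hdg.symm
  have gec := one_tip hae heg hac hab hbc.symm hcd hbd hdg.symm
  have gfb := one_tip haf hfg hab hac hbc hbd hcd hdg.symm
  have gfc := one_tip haf hfg hac hab hbc.symm hcd hbd hdg.symm
  clear two_tips two_tips' one_tip
  by_cases hva : G.Adj v a <;> by_cases hvb : G.Adj v b <;> by_cases hvc : G.Adj v c <;>
    by_cases hvd : G.Adj v d <;> by_cases hve : G.Adj v e <;> by_cases hvf : G.Adj v f <;>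
    by_cases hvg : G.Adj v g <;> simp_all

/-- A locally bipartite graph containing the Moser spindle `H₀` and
having minimum degree greater than `|G|/2` contains a copy of `H₁`. -/
theorem stmt_15 {V : Type*} [Fintype V] (G : SimpleGraph V) [DecidableRel G.Adj]
    (hloc : ∀ v : V, (G.induce (G.neighborSet v)).Colorable 2)
    (hH0 : ContainsCopy MoserSpindle G)
    (hδ : 2 * G.minDegree > Fintype.card V) :
    ContainsCopy GraphH1 G := by
  obtain ⟨x, -, hx⟩ := hH0
  exact containsCopy_graphH1_of_spindle hloc hδ (a := x 0) (b := x 1) (c := x 2) (d := x 3)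
    (e := x 5) (f := x 6) (g := x 4)
    (hx _ _ (by simp [MoserSpindle])) (hx _ _ (by simp [MoserSpindle]))
    (hx _ _ (by simp [MoserSpindle])) (hx _ _ (by simp [MoserSpindle]))
    (hx _ _ (by simp [MoserSpindle])) (hx _ _ (by simp [MoserSpindle]))
    (hx _ _ (by simp [MoserSpindle])) (hx _ _ (by simp [MoserSpindle]))
    (hx _ _ (by simp [MoserSpindle])) (hx _ _ (by simp [MoserSpindle]))
    (hx _ _ (by simp [MoserSpindle]))
end
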